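/- arXiv:2506.08928 — 3 statements merged into one kernel-verified Lean document; each statement's English description precedes it below -/
import Mathlib

section
/- Let s be a split of a node v into nonempty disjoint children v_L and v_R. Then the weighted impurity decrease equals the squared projection of the responses onto the stump function: |v| · Δ̂(s) = (Σ_{i=1}^{n} y_i · ψ(i; s))² / |v|; equivalently, Δ̂(s) = (Σ_{i=1}^{n} y_i · ψ(i; s))² / |v|². -/
open Finset

variable {n : ℕ}

/-- Mean response of the training samples in node `v`. -/
noncomputable def nodeMean (y : Fin n → ℝ) (v : Finset (Fin n)) : ℝ :=
  ((v.card : ℝ))⁻¹ * ∑ i ∈ v, y i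

/-- Stump function of the split of a node into children `vL`, `vR`. -/
noncomputable def stump (vL vR : Finset (Fin n)) (i : Fin n) : ℝ :=
  ((vR.card : ℝ) * (if i ∈ vL then (1 : ℝ) else 0)
      - (vL.card : ℝ) * (if i ∈ vR then (1 : ℝ) else 0))
    / Real.sqrt ((vL.card : ℝ) * (vR.card : ℝ))

/-- Impurity decrease of the split of node `vL ∪ vR` into children `vL`, `vR`. -/
noncomputable def impurityDecrease (y : Fin n → ℝ) (vL vR : Finset (Fin n)) : ℝ :=
  (((vL ∪ vR).card : ℝ))⁻¹ *
    ((∑ i ∈ vL ∪ vR, (y i - nodeMean y (vL ∪ vR)) ^ 2)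
      - (∑ i ∈ vL, (y i - nodeMean y vL) ^ 2)
      - (∑ i ∈ vR, (y i - nodeMean y vR) ^ 2))

/-- The sum of squared deviations from the node mean, in terms of raw moments. -/
theorem sum_sq_sub_nodeMean (y : Fin n → ℝ) {v : Finset (Fin n)} (hv : v.Nonempty) :
    ∑ i ∈ v, (y i - nodeMean y v) ^ 2 = ∑ i ∈ v, y i ^ 2 - (∑ i ∈ v, y i) ^ 2 / v.card := by
  have hc : (v.card : ℝ) ≠ 0 := Nat.cast_ne_zero.mpr hv.card_ne_zero
  simp only [sub_sq, sum_add_distrib, sum_sub_distrib, ← sum_mul, ← mul_sum, sum_const,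
    nsmul_eq_mul, nodeMean]
  field_simp
  ring

theorem sum_mul_stump (y : Fin n → ℝ) (vL vR : Finset (Fin n)) :
    ∑ i, y i * stump vL vR i = (vR.card * ∑ i ∈ vL, y i - vL.card * ∑ i ∈ vR, y i)
      / Real.sqrt ((vL.card : ℝ) * vR.card) := by
  simp only [stump, mul_div_assoc', ← sum_div, mul_sub, sum_sub_distrib, mul_ite, mul_one,
    mul_zero, sum_ite_mem, univ_inter, ← sum_mul, mul_comm]

theorem impurity_decrease_eq_sq_projection (y : Fin n → ℝ) (vL vR : Finset (Fin n))
    (hL : vL.Nonempty) (hR : vR.Nonempty) (hd : Disjoint vL vR) :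
    (((vL ∪ vR).card : ℝ) * impurityDecrease y vL vR
        = (∑ i, y i * stump vL vR i) ^ 2 / ((vL ∪ vR).card : ℝ))
    ∧ impurityDecrease y vL vR
        = (∑ i, y i * stump vL vR i) ^ 2 / (((vL ∪ vR).card : ℝ)) ^ 2 := by
  have hl : (0 : ℝ) < vL.card := Nat.cast_pos.mpr hL.card_pos
  have hr : (0 : ℝ) < vR.card := Nat.cast_pos.mpr hR.card_pos
  have hlr : (vL.card : ℝ) + vR.card ≠ 0 := by positivity
  have key : impurityDecrease y vL vR
      = (∑ i, y i * stump vL vR i) ^ 2 / (((vL ∪ vR).card : ℝ)) ^ 2 := by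
    rw [impurityDecrease, sum_sq_sub_nodeMean y (hL.mono subset_union_left),
      sum_sq_sub_nodeMean y hL, sum_sq_sub_nodeMean y hR, sum_mul_stump, div_pow,
      Real.sq_sqrt (by positivity), sum_union hd, sum_union hd, card_union_of_disjoint hd,
      Nat.cast_add]
    field_simp
    ring
  refine ⟨?_, key⟩
  rw [key, card_union_of_disjoint hd, Nat.cast_add]
  field_simp
end

section
/- Let s be a split of a node v into nonempty disjoint children v_L and v_R, and let s′ be a split of a node v′ into nonempty disjoint children v′_L and v′_R. If v′ ⊆ v_L or v′ ⊆ v_R (i.e., the node of s′ is contained in one child of s, so that ψ(·; s) is constant on v′), then the stump functions of s and s′ are orthogonal over the training samples: Σ_{i=1}^{n} ψ(i; s) · ψ(i; s′) = 0. -/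
open Finset

variable {n : ℕ}

/-- The stump function of a split sums to zero over the training samples. -/
theorem sum_stump (vL vR : Finset (Fin n)) : ∑ i, stump vL vR i = 0 := by
  simp only [stump, ← Finset.sum_div, Finset.sum_sub_distrib, ← Finset.mul_sum, Finset.sum_boole,
    Finset.filter_univ_mem]
  rw [mul_comm, sub_self, zero_div]

/-- The stump function of a split vanishes outside the split node. -/
theorem stump_eq_zero_of_notMem {vL vR : Finset (Fin n)} {i : Fin n} (hi : i ∉ vL ∪ vR) :
    stump vL vR i = 0 := by
  rw [Finset.mem_union, not_or] at hi
  simp [stump, hi.1, hi.2]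

/-- A function that is constant on a node is orthogonal to the stump function of any split
of that node. -/
theorem sum_mul_stump_eq_zero {vL vR : Finset (Fin n)} {f : Fin n → ℝ} {c : ℝ}
    (hf : ∀ i ∈ vL ∪ vR, f i = c) : ∑ i, f i * stump vL vR i = 0 := by
  have h (i : Fin n) : f i * stump vL vR i = c * stump vL vR i := by
    by_cases hi : i ∈ vL ∪ vR
    · rw [hf i hi]
    · rw [stump_eq_zero_of_notMem hi, mul_zero, mul_zero]
  simp only [h, ← Finset.mul_sum, sum_stump, mul_zero]

theorem stump_orthogonal_of_nested (vL vR vL' vR' : Finset (Fin n))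
    (hL : vL.Nonempty) (hR : vR.Nonempty) (hd : Disjoint vL vR)
    (hL' : vL'.Nonempty) (hR' : vR'.Nonempty) (hd' : Disjoint vL' vR')
    (hnest : (vL' ∪ vR') ⊆ vL ∨ (vL' ∪ vR') ⊆ vR) :
    ∑ i, stump vL vR i * stump vL' vR' i = 0 := by
  rcases hnest with h | h
  · refine sum_mul_stump_eq_zero (c := vR.card / Real.sqrt (vL.card * vR.card)) fun i hi => ?_
    simp [stump, h hi, Finset.disjoint_left.mp hd (h hi)]
  · refine sum_mul_stump_eq_zero (c := -vL.card / Real.sqrt (vL.card * vR.card)) fun i hi => ?_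
    simp [stump, h hi, Finset.disjoint_right.mp hd (h hi)]
end

section
/- Let S = {s_1, …, s_m} be a finite family of splits, where s_j is a split of node v_j into nonempty disjoint children v_{L,j} and v_{R,j}, satisfying the tree (laminar) condition: for every pair j ≠ j′, either v_j ∩ v_{j′} = ∅, or v_j ⊆ v_{L,j′}, or v_j ⊆ v_{R,j′}, or v_{j′} ⊆ v_{L,j}, or v_{j′} ⊆ v_{R,j}. Then the stump functions of distinct splits in S are pairwise orthogonal over the training samples: for all j ≠ j′, Σ_{i=1}^{n} ψ(i; s_j) · ψ(i; s_{j′}) = 0. -/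
open Finset

variable {n : ℕ}

/-- A stump function is orthogonal to any function that is constant on its node. -/
theorem sum_stump_mul_eq_zero {vL vR : Finset (Fin n)} {g : Fin n → ℝ} {c : ℝ}
    (hg : ∀ i ∈ vL ∪ vR, g i = c) : ∑ i, stump vL vR i * g i = 0 := by
  have h : ∀ i, stump vL vR i * g i = stump vL vR i * c := fun i => by
    by_cases hi : i ∈ vL ∪ vR
    · rw [hg i hi]
    · simp [stump_eq_zero_of_notMem hi]
  simp only [h, ← Finset.sum_mul, sum_stump, zero_mul]

theorem exists_stump_eq_const_of_subset {vL vR w : Finset (Fin n)} (hd : Disjoint vL vR)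
    (hw : w ⊆ vL ∨ w ⊆ vR) : ∃ c, ∀ i ∈ w, stump vL vR i = c := by
  rcases hw with hw | hw
  · refine ⟨vR.card / √(vL.card * vR.card), fun i hi => ?_⟩
    simp [stump, hw hi, Finset.disjoint_left.mp hd (hw hi)]
  · refine ⟨-vL.card / √(vL.card * vR.card), fun i hi => ?_⟩
    simp [stump, hw hi, Finset.disjoint_right.mp hd (hw hi)]

theorem stump_pairwise_orthogonal {m : ℕ} (vL vR : Fin m → Finset (Fin n))
    (hL : ∀ j, (vL j).Nonempty) (hR : ∀ j, (vR j).Nonempty)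
    (hd : ∀ j, Disjoint (vL j) (vR j))
    (laminar : ∀ j j', j ≠ j' →
      Disjoint (vL j ∪ vR j) (vL j' ∪ vR j')
      ∨ (vL j ∪ vR j) ⊆ vL j' ∨ (vL j ∪ vR j) ⊆ vR j'
      ∨ (vL j' ∪ vR j') ⊆ vL j ∨ (vL j' ∪ vR j') ⊆ vR j) :
    ∀ j j', j ≠ j' →
      ∑ i, stump (vL j) (vR j) i * stump (vL j') (vR j') i = 0 := by
  intro j j' hne
  have nested : ∀ a b, (vL a ∪ vR a ⊆ vL b ∨ vL a ∪ vR a ⊆ vR b) →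
      ∑ i, stump (vL a) (vR a) i * stump (vL b) (vR b) i = 0 := fun a b h =>
    let ⟨_, hc⟩ := exists_stump_eq_const_of_subset (hd b) h
    sum_stump_mul_eq_zero hc
  rcases laminar j j' hne with h | h | h | h | h
  · exact sum_stump_mul_eq_zero fun i hi =>
      stump_eq_zero_of_notMem (Finset.disjoint_left.mp h hi)
  · exact nested j j' (.inl h)
  · exact nested j j' (.inr h)
  · simpa only [mul_comm] using nested j' j (.inl h)
  · simpa only [mul_comm] using nested j' j (.inr h)
end
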